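/- The radical of the bilinear form q on M equals the ideal I: for homogeneous c ∈ A₁^{⊗l}, if q(a, c) = 0 for all homogeneous a ∈ A₁^{⊗k} with k + l ≡ 2 mod p (1 ≤ k ≤ p), then c ∈ I_l. Consequently the form induced by q on the quotient A = M/I is nondegenerate. -/

import Mathlib

open scoped TensorProduct DirectSum

noncomputable section

/-- The pure tensor `a₀ ⊗ a₁ ⊗ ⋯ ⊗ a_{m-1}` in the `m`-th tensor power. -/
def tp (A : Type) [AddCommGroup A] [Module ℂ A] (m : ℕ) (a : ℕ → A) : ⨂[ℂ]^m A :=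
  PiTensorProduct.tprod ℂ (fun i : Fin m => a i.1)

/-- The space `M = ⊕_{k=1}^{p} A₁^{⊗k}`; the component of index `k : Fin p` is the
tensor power of degree `k + 1`. -/
abbrev Mspace (p : ℕ) (A : Type) [AddCommGroup A] [Module ℂ A] : Type :=
  ⨁ k : Fin p, ⨂[ℂ]^(k.1 + 1) A

/-- Inclusion of the degree-`(k+1)` homogeneous component into `M`. -/
def incl (p : ℕ) (A : Type) [AddCommGroup A] [Module ℂ A] (k : Fin p) :
    (⨂[ℂ]^(k.1 + 1) A) →ₗ[ℂ] Mspace p A :=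
  DirectSum.lof ℂ (Fin p) (fun k : Fin p => ⨂[ℂ]^(k.1 + 1) A) k

/-- The one-step substitution `id^{⊗r} ⊗ Γ ⊗ id^{⊗(n-2-r)}` followed by `Γ`, evaluated on
a family of `2n−3` arguments; used to state the general associativity condition. -/
def gammaIns (n : ℕ) (A : Type) [AddCommGroup A] [Module ℂ A]
    (Γ : MultilinearMap ℂ (fun _ : Fin (n - 1) => A) A) (r : ℕ) (a : ℕ → A) : A :=
  Γ (fun i : Fin (n - 1) =>
    if i.1 < r then a i.1
    else if i.1 = r then Γ (fun j : Fin (n - 1) => a (r + j.1))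
    else a (i.1 + (n - 2)))

/-- `mul` is the bilinear multiplication of `M = ⊕_{k=1}^{p} A₁^{⊗k}` determined on
homogeneous pure tensors `a = a₁⊗⋯⊗a_k`, `b = b₁⊗⋯⊗b_l` by: `a·b = a ⊗ b` if
`k + l ≤ p`, and `a·b = Γ(a₁,…,a_k,b₁,…,b_{p+1−k}) ⊗ b_{p+2−k} ⊗ ⋯ ⊗ b_l` if
`k + l > p`. -/
def MulSpec (n p : ℕ) (A : Type) [AddCommGroup A] [Module ℂ A]
    (Γ : MultilinearMap ℂ (fun _ : Fin (n - 1) => A) A)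
    (mul : Mspace p A →ₗ[ℂ] Mspace p A →ₗ[ℂ] Mspace p A) : Prop :=
  ∀ (k l : Fin p) (a b : ℕ → A),
    mul (incl p A k (tp A (k.1 + 1) a)) (incl p A l (tp A (l.1 + 1) b)) =
      if h : (k.1 + 1) + (l.1 + 1) ≤ p then
        incl p A ⟨k.1 + l.1 + 1, by omega⟩
          (tp A (k.1 + l.1 + 1 + 1)
            (fun i => if i < k.1 + 1 then a i else b (i - (k.1 + 1))))
      else
        incl p A ⟨k.1 + l.1 + 1 - p, by have := k.isLt; have := l.isLt; omega⟩
          (tp A (k.1 + l.1 + 1 - p + 1)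
            (fun i =>
              if i = 0 then
                Γ (fun j : Fin (n - 1) =>
                  if j.1 < k.1 + 1 then a j.1 else b (j.1 - (k.1 + 1)))
              else b (p - (k.1 + 1) + i)))

/-- The subspace `I_k ⊆ A₁^{⊗k}`: `I₁ = {0}`, and for `2 ≤ k ≤ p`,
`I_k = {a : a·b = 0 for all b ∈ A₁^{⊗(p+1−k)}}`.  (The component of index `k : Fin p`
has degree `k + 1`.) -/
def Ik (p : ℕ) (A : Type) [AddCommGroup A] [Module ℂ A]
    (mul : Mspace p A →ₗ[ℂ] Mspace p A →ₗ[ℂ] Mspace p A) (k : Fin p) :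
    Submodule ℂ (⨂[ℂ]^(k.1 + 1) A) :=
  if k.1 = 0 then ⊥
  else
    ⨅ y : ⨂[ℂ]^(p - (k.1 + 1) + 1) A,
      LinearMap.ker
        ((mul.flip (incl p A ⟨p - (k.1 + 1), by have := k.isLt; omega⟩ y)).comp (incl p A k))

/-- The subspace `I = ⊕_{k=1}^{p} I_k ⊆ M`. -/
def Isub (p : ℕ) (A : Type) [AddCommGroup A] [Module ℂ A]
    (mul : Mspace p A →ₗ[ℂ] Mspace p A →ₗ[ℂ] Mspace p A) : Submodule ℂ (Mspace p A) :=
  ⨆ k : Fin p, (Ik p A mul k).map (incl p A k)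

/-- `qM` is the bilinear form on `M` determined on homogeneous pure tensors
`a ∈ A₁^{⊗k}`, `b ∈ A₁^{⊗l}` by: `q(a,b) = 0` if `k + l ≢ 2 mod p`;
`q(a,b) = q₁(a₁, Γ(a₂,…,a_k,b₁,…,b_l))` if `k + l = n`; and `q(a,b) = q₁(a₁,b₁)` if
`k = l = 1`. -/
def QSpec (n p : ℕ) (A : Type) [AddCommGroup A] [Module ℂ A]
    (Γ : MultilinearMap ℂ (fun _ : Fin (n - 1) => A) A)
    (q₁ : A →ₗ[ℂ] A →ₗ[ℂ] ℂ)
    (qM : Mspace p A →ₗ[ℂ] Mspace p A →ₗ[ℂ] ℂ) : Prop :=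
  ∀ (k l : Fin p) (a b : ℕ → A),
    qM (incl p A k (tp A (k.1 + 1) a)) (incl p A l (tp A (l.1 + 1) b)) =
      if ((k.1 + 1) + (l.1 + 1)) % p = 2 % p then
        (if (k.1 + 1) + (l.1 + 1) = n then
          q₁ (a 0) (Γ (fun j : Fin (n - 1) =>
            if j.1 + 1 < k.1 + 1 then a (j.1 + 1) else b (j.1 + 1 - (k.1 + 1))))
        else q₁ (a 0) (b 0))
      else 0

/-- `G a = q₁(a₀, Γ(a₁,…,a_{n-1}))`. -/
def cyc (n : ℕ) (A : Type) [AddCommGroup A] [Module ℂ A]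
    (Γ : MultilinearMap ℂ (fun _ : Fin (n - 1) => A) A)
    (q₁ : A →ₗ[ℂ] A →ₗ[ℂ] ℂ) (a : ℕ → A) : ℂ :=
  q₁ (a 0) (Γ (fun i : Fin (n - 1) => a (i.1 + 1)))

theorem cyc_congr {n : ℕ} (hn : 3 ≤ n) {A : Type} [AddCommGroup A] [Module ℂ A]
    (Γ : MultilinearMap ℂ (fun _ : Fin (n - 1) => A) A)
    (q₁ : A →ₗ[ℂ] A →ₗ[ℂ] ℂ) (a b : ℕ → A) (h : ∀ i < n, a i = b i) :
    cyc n A Γ q₁ a = cyc n A Γ q₁ b := by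
  unfold cyc
  have : (fun i : Fin (n - 1) => a (i.1 + 1)) = (fun i : Fin (n - 1) => b (i.1 + 1)) := by
    funext i
    exact h _ (by have := i.isLt; omega)
  rw [h 0 (by omega), this]

theorem cyc_rot {n : ℕ} (hn : 3 ≤ n) {A : Type} [AddCommGroup A] [Module ℂ A]
    (Γ : MultilinearMap ℂ (fun _ : Fin (n - 1) => A) A)
    (q₁ : A →ₗ[ℂ] A →ₗ[ℂ] ℂ)
    (hq₁symm : ∀ x y : A, q₁ x y = q₁ y x)
    (hinv : ∀ a : ℕ → A,
      q₁ (Γ (fun i : Fin (n - 1) => a i.1)) (a (n - 1)) =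
        q₁ (a 0) (Γ (fun i : Fin (n - 1) => a (i.1 + 1)))) (r : ℕ) (a : ℕ → A) :
    cyc n A Γ q₁ a = cyc n A Γ q₁ (fun i => a ((i + r) % n)) := by
  induction r with
  | zero =>
    apply cyc_congr hn
    intro i hi
    simp [Nat.mod_eq_of_lt hi]
  | succ r ih =>
    rw [ih]
    have key : ∀ c : ℕ → A, cyc n A Γ q₁ c = cyc n A Γ q₁ (fun i => c ((i + 1) % n)) := by
      intro c
      have h := hinv (fun i => c ((i + 1) % n))
      have e1 : (n - 1 + 1) % n = 0 := by
        rw [Nat.sub_add_cancel (by omega)]; exact Nat.mod_self n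
      have e2 : (fun i : Fin (n - 1) => c ((i.1 + 1) % n)) =
          (fun i : Fin (n - 1) => c (i.1 + 1)) := by
        funext i
        rw [Nat.mod_eq_of_lt (by have := i.isLt; omega)]
      simp only [e1, e2] at h
      unfold cyc
      rw [hq₁symm, h]
    rw [key]
    apply cyc_congr hn
    intro i hi
    simp only [Nat.mod_add_mod]
    congr 2
    ring

theorem tp_ext {A : Type} [AddCommGroup A] [Module ℂ A] {N : Type} [AddCommGroup N]
    [Module ℂ N] {m : ℕ} (f g : (⨂[ℂ]^m A) →ₗ[ℂ] N)
    (h : ∀ a : ℕ → A, f (tp A m a) = g (tp A m a)) : f = g := by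
  apply PiTensorProduct.ext
  apply MultilinearMap.ext
  intro v
  have := h (fun i => if hi : i < m then v ⟨i, hi⟩ else 0)
  simpa [tp] using this

theorem incl_tp_congr {p : ℕ} {A : Type} [AddCommGroup A] [Module ℂ A] (k k' : Fin p)
    (h : k.1 = k'.1) (a b : ℕ → A) (hab : ∀ i < k.1 + 1, a i = b i) :
    incl p A k (tp A (k.1 + 1) a) = incl p A k' (tp A (k'.1 + 1) b) := by
  obtain rfl : k = k' := Fin.ext h
  unfold tp
  congr 2
  funext i
  exact hab _ i.isLt

instance subsingletonFinZeroAddOne : Subsingleton (Fin (0 + 1)) :=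
  inferInstanceAs (Subsingleton (Fin 1))

/-- degree one component, as an element of `A`. -/
def ev (p : ℕ) (hp : 0 < p) (A : Type) [AddCommGroup A] [Module ℂ A] :
    Mspace p A →ₗ[ℂ] A :=
  (PiTensorProduct.lift
      (MultilinearMap.ofSubsingleton ℂ A A (0 : Fin (0 + 1)) LinearMap.id)).comp
    (DirectSum.component ℂ (Fin p) (fun k : Fin p => ⨂[ℂ]^(k.1 + 1) A) ⟨0, hp⟩)


/-- inclusion of `A` as degree one. -/
def iota (p : ℕ) (hp : 0 < p) (A : Type) [AddCommGroup A] [Module ℂ A] :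
    A →ₗ[ℂ] Mspace p A :=
  (incl p A ⟨0, hp⟩).comp
    ((MultilinearMap.ofSubsingleton ℂ A (⨂[ℂ]^(0 + 1) A) (0 : Fin (0 + 1))).symm
      (PiTensorProduct.tprod ℂ))

theorem iota_apply (p : ℕ) (hp : 0 < p) (A : Type) [AddCommGroup A] [Module ℂ A] (x : A) :
    iota p hp A x = incl p A ⟨0, hp⟩ (tp A (0 + 1) (fun _ => x)) := by
  rfl

theorem ev_incl (p : ℕ) (hp : 0 < p) (A : Type) [AddCommGroup A] [Module ℂ A] (a : ℕ → A) :
    ev p hp A (incl p A ⟨0, hp⟩ (tp A (0 + 1) a)) = a 0 := by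
  simp only [ev, incl, LinearMap.comp_apply]
  erw [DirectSum.component.lof_self]
  simp [tp]

theorem qM_symm {n p : ℕ} (hn : 3 ≤ n) (hp : p = n - 2)
    {A : Type} [AddCommGroup A] [Module ℂ A]
    (Γ : MultilinearMap ℂ (fun _ : Fin (n - 1) => A) A)
    (q₁ : A →ₗ[ℂ] A →ₗ[ℂ] ℂ)
    (hq₁symm : ∀ x y : A, q₁ x y = q₁ y x)
    (hinv : ∀ a : ℕ → A,
      q₁ (Γ (fun i : Fin (n - 1) => a i.1)) (a (n - 1)) =
        q₁ (a 0) (Γ (fun i : Fin (n - 1) => a (i.1 + 1))))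
    (qM : Mspace p A →ₗ[ℂ] Mspace p A →ₗ[ℂ] ℂ)
    (hqM : QSpec n p A Γ q₁ qM) : qM = qM.flip := by
  apply DirectSum.linearMap_ext
  intro k
  apply tp_ext
  intro a
  apply DirectSum.linearMap_ext
  intro l
  apply tp_ext
  intro b
  change qM (incl p A k (tp A _ a)) (incl p A l (tp A _ b)) =
    qM (incl p A l (tp A _ b)) (incl p A k (tp A _ a))
  rw [hqM, hqM, Nat.add_comm (l.1 + 1)]
  split_ifs with h1 h2
  · have h := cyc_rot hn Γ q₁ hq₁symm hinv (k.1 + 1)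
      (fun i => if i < k.1 + 1 then a i else b (i - (k.1 + 1)))
    rw [cyc_congr hn Γ q₁ (fun i => (fun i => if i < k.1 + 1 then a i else b (i - (k.1 + 1)))
      ((i + (k.1 + 1)) % n)) (fun i => if i < l.1 + 1 then b i else a (i - (l.1 + 1)))] at h
    · simpa [cyc] using h
    · intro i hi
      by_cases hil : i < l.1 + 1
      · have : (i + (k.1 + 1)) % n = i + (k.1 + 1) := Nat.mod_eq_of_lt (by omega)
        simp only [this, hil, if_true]
        rw [if_neg (by omega), Nat.add_sub_cancel]
      · have : (i + (k.1 + 1)) % n = i - (l.1 + 1) := by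
          rw [show i + (k.1 + 1) = i - (l.1 + 1) + n by omega, Nat.add_mod_right]
          exact Nat.mod_eq_of_lt (by omega)
        simp only [this, hil, if_false]
        rw [if_pos (by omega)]
  · exact hq₁symm _ _
  · rfl

theorem qM_off {n p : ℕ}
    {A : Type} [AddCommGroup A] [Module ℂ A]
    (Γ : MultilinearMap ℂ (fun _ : Fin (n - 1) => A) A)
    (q₁ : A →ₗ[ℂ] A →ₗ[ℂ] ℂ)
    (qM : Mspace p A →ₗ[ℂ] Mspace p A →ₗ[ℂ] ℂ)
    (hqM : QSpec n p A Γ q₁ qM) (k l : Fin p)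
    (h : ((k.1 + 1) + (l.1 + 1)) % p ≠ 2 % p) (a : ⨂[ℂ]^(k.1 + 1) A) (b : ⨂[ℂ]^(l.1 + 1) A) :
    qM (incl p A k a) (incl p A l b) = 0 := by
  have : (qM.compl₁₂ (incl p A k) (incl p A l)) = 0 := by
    apply tp_ext
    intro a
    apply tp_ext
    intro b
    simp only [LinearMap.compl₁₂_apply, LinearMap.zero_apply]
    rw [hqM, if_neg h]
  exact LinearMap.congr_fun (LinearMap.congr_fun this a) b

theorem part_one
    (n p : ℕ) (hn : 3 ≤ n) (hp : p = n - 2)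
    (A : Type) [AddCommGroup A] [Module ℂ A]
    (Γ : MultilinearMap ℂ (fun _ : Fin (n - 1) => A) A)
    (q₁ : A →ₗ[ℂ] A →ₗ[ℂ] ℂ)
    (hq₁symm : ∀ x y : A, q₁ x y = q₁ y x)
    (hq₁nondeg : ∀ x : A, (∀ y : A, q₁ x y = 0) → x = 0)
    (hinv : ∀ a : ℕ → A,
      q₁ (Γ (fun i : Fin (n - 1) => a i.1)) (a (n - 1)) =
        q₁ (a 0) (Γ (fun i : Fin (n - 1) => a (i.1 + 1))))
    (mul : Mspace p A →ₗ[ℂ] Mspace p A →ₗ[ℂ] Mspace p A)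
    (hmul : MulSpec n p A Γ mul)
    (qM : Mspace p A →ₗ[ℂ] Mspace p A →ₗ[ℂ] ℂ)
    (hqM : QSpec n p A Γ q₁ qM) (l : Fin p) (c : ⨂[ℂ]^(l.1 + 1) A)
    (hc : ∀ k : Fin p, ((k.1 + 1) + (l.1 + 1)) % p = 2 % p →
        ∀ a : ⨂[ℂ]^(k.1 + 1) A, qM (incl p A k a) (incl p A l c) = 0) :
    c ∈ Ik p A mul l := by
  have hp0 : 0 < p := by omega
  unfold Ik
  split_ifs with hl
  · obtain ⟨l, hlt⟩ := l
    simp only at hl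
    subst hl
    rw [Submodule.mem_bot]
    have e1 : (iota p hp0 A) ∘ₗ (ev p hp0 A) ∘ₗ (incl p A ⟨0, hlt⟩) = incl p A ⟨0, hlt⟩ := by
      apply tp_ext
      intro a
      rw [LinearMap.comp_apply, LinearMap.comp_apply, ev_incl, iota_apply]
      apply incl_tp_congr _ _ rfl
      intro i hi
      obtain rfl : i = 0 := by simpa using hi
      rfl
    have e2 : ∀ x : A, (q₁ x) ∘ₗ (ev p hp0 A) ∘ₗ (incl p A ⟨0, hlt⟩) =
        (qM (iota p hp0 A x)) ∘ₗ (incl p A ⟨0, hlt⟩) := by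
      intro x
      apply tp_ext
      intro a
      rw [LinearMap.comp_apply, LinearMap.comp_apply, LinearMap.comp_apply, ev_incl, iota_apply]
      have := hqM ⟨0, hlt⟩ ⟨0, hlt⟩ (fun _ => x) a
      rw [this, if_pos (by simp), if_neg (by simp; omega)]
    have e3 : ev p hp0 A (incl p A ⟨0, hlt⟩ c) = 0 := by
      apply hq₁nondeg
      intro y
      rw [hq₁symm]
      have := LinearMap.congr_fun (e2 y) c
      simp only [LinearMap.comp_apply] at this
      rw [this, iota_apply]
      exact hc ⟨0, hlt⟩ rfl _
    have e4 := LinearMap.congr_fun e1 c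
    simp only [LinearMap.comp_apply] at e4
    rw [e3, map_zero] at e4
    exact DirectSum.of_injective (β := fun k : Fin p => ⨂[ℂ]^(k.1 + 1) A) ⟨0, hlt⟩
      (e4.symm.trans (map_zero _).symm)
  · rw [Submodule.mem_iInf]
    intro y
    rw [LinearMap.mem_ker]
    have hlt := l.isLt
    set l' : Fin p := ⟨p - (l.1 + 1), by omega⟩ with hl'
    suffices H : (mul (incl p A l c)) ∘ₗ (incl p A l') = 0 from LinearMap.congr_fun H y
    apply tp_ext
    intro b
    rw [LinearMap.comp_apply, LinearMap.zero_apply]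
    have e0 : ∀ a : ℕ → A, mul (incl p A l (tp A (l.1 + 1) a)) (incl p A l' (tp A (l'.1 + 1) b))
        = iota p hp0 A (Γ (fun j : Fin (n - 1) =>
                  if j.1 < l.1 + 1 then a j.1 else b (j.1 - (l.1 + 1)))) := by
      intro a
      rw [hmul, dif_neg (by simp only [hl']; omega), iota_apply]
      apply incl_tp_congr
      · simp only [hl']; omega
      · intro i hi
        simp only [hl'] at hi
        obtain rfl : i = 0 := by omega
        simp
    have eviota : ∀ x, ev p hp0 A (iota p hp0 A x) = x := by
      intro x
      rw [iota_apply, ev_incl]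
    have e1 : (iota p hp0 A) ∘ₗ (ev p hp0 A) ∘ₗ
        (mul.flip (incl p A l' (tp A (l'.1 + 1) b))) ∘ₗ (incl p A l) =
        (mul.flip (incl p A l' (tp A (l'.1 + 1) b))) ∘ₗ (incl p A l) := by
      apply tp_ext
      intro a
      simp only [LinearMap.comp_apply, LinearMap.flip_apply]
      rw [e0, eviota]
    set k : Fin p := ⟨p - l.1, by omega⟩ with hk
    have e2 : ∀ x : A, (q₁ x) ∘ₗ (ev p hp0 A) ∘ₗ
        (mul.flip (incl p A l' (tp A (l'.1 + 1) b))) ∘ₗ (incl p A l) =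
        (qM (incl p A k (tp A (k.1 + 1) (fun i => if i < p - l.1 then b i else x))))
          ∘ₗ (incl p A l) := by
      intro x
      apply tp_ext
      intro a
      simp only [LinearMap.comp_apply, LinearMap.flip_apply]
      have hkl : k.1 + 1 + (l.1 + 1) = n := by simp only [hk]; omega
      rw [e0, eviota, hqM, if_pos (by rw [hkl, show n = 2 + p by omega, Nat.add_mod_right]),
        if_pos hkl]
      let s : ℕ → A := fun i => if i < l.1 + 1 then a i else
        if i < n - 1 then b (i - (l.1 + 1)) else x
      have h1 := hinv s
      have h2 := cyc_rot hn Γ q₁ hq₁symm hinv (l.1 + 1) s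
      have h3 := cyc_congr hn Γ q₁ (fun i => s ((i + (l.1 + 1)) % n))
        (fun i => if i < k.1 + 1 then (if i < p - l.1 then b i else x) else a (i - (k.1 + 1))) (by
          intro i hi
          simp only [hk]
          by_cases hik : i < p - l.1 + 1
          · have : (i + (l.1 + 1)) % n = i + (l.1 + 1) := Nat.mod_eq_of_lt (by omega)
            simp only [this, s]
            rw [if_neg (by omega), if_pos hik]
            by_cases hi2 : i < p - l.1
            · rw [if_pos (by omega), if_pos hi2, Nat.add_sub_cancel]
            · rw [if_neg (by omega), if_neg hi2]
          · have : (i + (l.1 + 1)) % n = i - (p - l.1 + 1) := by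
              rw [show i + (l.1 + 1) = i - (p - l.1 + 1) + n by omega, Nat.add_mod_right]
              exact Nat.mod_eq_of_lt (by omega)
            simp only [this, s]
            rw [if_pos (by omega), if_neg hik])
      have h4 : s (n - 1) = x := by
        simp only [s]
        rw [if_neg (by omega), if_neg (by omega)]
      have h5 : (fun i : Fin (n - 1) => s i.1) = (fun j : Fin (n - 1) =>
                  if j.1 < l.1 + 1 then a j.1 else b (j.1 - (l.1 + 1))) := by
        funext j
        simp only [s, j.isLt, if_true]
      rw [h4, h5] at h1
      rw [hq₁symm, h1]
      refine (h2.trans h3).trans ?_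
      simp [cyc]
    have e3 : ev p hp0 A (mul (incl p A l c) (incl p A l' (tp A (l'.1 + 1) b))) = 0 := by
      apply hq₁nondeg
      intro x
      rw [hq₁symm]
      have := LinearMap.congr_fun (e2 x) c
      simp only [LinearMap.comp_apply, LinearMap.flip_apply] at this
      rw [this]
      refine hc k ?_ _
      rw [show k.1 + 1 + (l.1 + 1) = 2 + p by simp only [hk]; omega, Nat.add_mod_right]
    have e4 := LinearMap.congr_fun e1 c
    simp only [LinearMap.comp_apply, LinearMap.flip_apply] at e4
    rw [e3, map_zero] at e4
    exact e4.symm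

/-- The radical of the bilinear form `q` on `M` equals the ideal `I`:
for homogeneous `c ∈ A₁^{⊗l}`, if `q(a, c) = 0` for all homogeneous `a ∈ A₁^{⊗k}` with
`k + l ≡ 2 mod p`, then `c ∈ I_l`.  Consequently the form induced by `q` on the quotient
`A = M/I` is nondegenerate. -/
theorem radical_of_qM_eq_Isub
    (n p : ℕ) (hn : 3 ≤ n) (hp : p = n - 2)
    (A : Type) [AddCommGroup A] [Module ℂ A] [FiniteDimensional ℂ A]
    (Γ : MultilinearMap ℂ (fun _ : Fin (n - 1) => A) A)
    (q₁ : A →ₗ[ℂ] A →ₗ[ℂ] ℂ)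
    (hq₁symm : ∀ x y : A, q₁ x y = q₁ y x)
    (hq₁nondeg : ∀ x : A, (∀ y : A, q₁ x y = 0) → x = 0)
    (hinv : ∀ a : ℕ → A,
      q₁ (Γ (fun i : Fin (n - 1) => a i.1)) (a (n - 1)) =
        q₁ (a 0) (Γ (fun i : Fin (n - 1) => a (i.1 + 1))))
    (hassoc : ∀ r s : ℕ, r ≤ n - 2 → s ≤ n - 2 → ∀ a : ℕ → A,
      gammaIns n A Γ r a = gammaIns n A Γ s a)
    (mul : Mspace p A →ₗ[ℂ] Mspace p A →ₗ[ℂ] Mspace p A)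
    (hmul : MulSpec n p A Γ mul)
    (qM : Mspace p A →ₗ[ℂ] Mspace p A →ₗ[ℂ] ℂ)
    (hqM : QSpec n p A Γ q₁ qM)
    (qA : (Mspace p A ⧸ Isub p A mul) →ₗ[ℂ] (Mspace p A ⧸ Isub p A mul) →ₗ[ℂ] ℂ)
    (hqA : ∀ a b : Mspace p A,
      qA ((Isub p A mul).mkQ a) ((Isub p A mul).mkQ b) = qM a b) :
    (∀ l : Fin p, ∀ c : ⨂[ℂ]^(l.1 + 1) A,
      (∀ k : Fin p, ((k.1 + 1) + (l.1 + 1)) % p = 2 % p →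
        ∀ a : ⨂[ℂ]^(k.1 + 1) A, qM (incl p A k a) (incl p A l c) = 0) →
      c ∈ Ik p A mul l) ∧
    (∀ x : Mspace p A ⧸ Isub p A mul,
      (∀ y : Mspace p A ⧸ Isub p A mul, qA x y = 0) → x = 0) := by
  have P1 := part_one n p hn hp A Γ q₁ hq₁symm hq₁nondeg hinv mul hmul qM hqM
  refine ⟨P1, ?_⟩
  intro x hx
  obtain ⟨m, rfl⟩ := (Isub p A mul).mkQ_surjective x
  have hm : ∀ m', qM m' m = 0 := by
    intro m'
    rw [qM_symm hn hp Γ q₁ hq₁symm hinv qM hqM, LinearMap.flip_apply, ← hqA]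
    exact hx _
  rw [Submodule.mkQ_apply, Submodule.Quotient.mk_eq_zero]
  have hsum : m = ∑ k : Fin p, incl p A k (m k) := by
    conv_lhs => rw [← DirectSum.sum_univ_of m]
    rfl
  rw [hsum]
  refine Submodule.sum_mem _ ?_
  intro l _
  refine Submodule.mem_iSup_of_mem l (Submodule.mem_map_of_mem ?_)
  apply P1
  intro k hk a
  have h := hm (incl p A k a)
  rw [hsum, map_sum, Finset.sum_eq_single l] at h
  · exact h
  · intro l' _ hne
    apply qM_off Γ q₁ qM hqM
    intro hk'
    apply hne
    have h1 : (k.1 + 1 + 1 + l'.1) ≡ (k.1 + 1 + 1 + l.1) [MOD p] := by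
      have : (k.1 + 1 + (l'.1 + 1)) % p = (k.1 + 1 + (l.1 + 1)) % p := hk'.trans hk.symm
      unfold Nat.ModEq
      convert this using 2 <;> ring
    have h2 := Nat.ModEq.add_left_cancel' _ h1
    exact Fin.ext (Nat.ModEq.eq_of_lt_of_lt h2 l'.isLt l.isLt)
  · intro hl
    exact absurd (Finset.mem_univ l) hl
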